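/- Let R > 0 and A, B, ξ₁, ξ₂, ξ₃ ∈ ℝ with A ≠ 0 and ξ₁ ≠ 0, and for a > 0 and r > 0 define F(a,r) = (A·r·(I₁(√a·R)·(2ξ₁ − ξ₂) − ξ₁·√a·R·I₀(√a·R)) + B·ξ₃·R·I₁(√a·r)) / (A·(I₁(√a·R)·(2ξ₁ − ξ₂) − ξ₁·√a·R·I₀(√a·R)) + B·ξ₃·I₁(√a·R)). Then for every fixed r with 0 < r < R, lim_{a→∞} F(a,r) = r. (Hence the closed-form radial displacement u_r = (U₀/R)·F(a,r) of the relaxed micromorphic extension problem tends to the classical linear-elastic solution U₀·r/R as the characteristic length L_c → 0, i.e. a → ∞.) -/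

import Mathlib

open Real Filter Set

/-- Modified Bessel function of the first kind of order zero:
`I₀(x) = ∑ x^(2n) / (4^n (n!)²)`. -/
noncomputable def I0 (x : ℝ) : ℝ :=
  ∑' n : ℕ, x ^ (2 * n) / ((4 : ℝ) ^ n * ((n.factorial : ℝ)) ^ 2)

/-- Modified Bessel function of the first kind of order one:
`I₁(x) = ∑ x^(2n+1) / (2^(2n+1) n! (n+1)!)`. -/
noncomputable def I1 (x : ℝ) : ℝ :=
  ∑' n : ℕ, x ^ (2 * n + 1) /
    ((2 : ℝ) ^ (2 * n + 1) * (n.factorial : ℝ) * (((n + 1).factorial : ℝ)))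

theorem summable_I0 (x : ℝ) :
    Summable fun n : ℕ => x ^ (2 * n) / ((4 : ℝ) ^ n * ((n.factorial : ℝ)) ^ 2) := by
  refine Summable.of_nonneg_of_le (fun n => ?_) (fun n => ?_)
    (Real.summable_pow_div_factorial (x ^ 2 / 4))
  · rw [pow_mul]; positivity
  · have h : (1 : ℝ) ≤ n.factorial := by exact_mod_cast n.factorial_pos
    rw [pow_mul, div_pow, div_div]
    gcongr
    nlinarith

theorem I1_term_le_I0_terms (x : ℝ) (n : ℕ) :
    x ^ (2 * n + 1) / ((2 : ℝ) ^ (2 * n + 1) * (n.factorial : ℝ) * (((n + 1).factorial : ℝ))) ≤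
      (x ^ (2 * n) / ((4 : ℝ) ^ n * ((n.factorial : ℝ)) ^ 2) +
        x ^ (2 * (n + 1)) / ((4 : ℝ) ^ (n + 1) * (((n + 1).factorial : ℝ)) ^ 2)) / 2 := by
  have h4 (m : ℕ) : (4 : ℝ) ^ m = (2 ^ m) ^ 2 := by
    rw [← pow_mul, mul_comm, pow_mul]; norm_num
  have h := two_mul_le_add_sq (x ^ n / (2 ^ n * (n.factorial : ℝ)))
    (x ^ (n + 1) / (2 ^ (n + 1) * ((n + 1).factorial : ℝ)))
  have e₁ : x ^ (2 * n + 1) /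
      ((2 : ℝ) ^ (2 * n + 1) * (n.factorial : ℝ) * (((n + 1).factorial : ℝ))) =
      x ^ n / (2 ^ n * (n.factorial : ℝ)) *
        (x ^ (n + 1) / (2 ^ (n + 1) * ((n + 1).factorial : ℝ))) := by
    rw [div_mul_div_comm]; congr 1 <;> ring
  have e₂ (m : ℕ) : x ^ (2 * m) / ((4 : ℝ) ^ m * ((m.factorial : ℝ)) ^ 2) =
      (x ^ m / (2 ^ m * (m.factorial : ℝ))) ^ 2 := by
    rw [div_pow, h4]; congr 1 <;> ring
  rw [e₁, e₂, e₂]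
  linarith

theorem summable_I1 {x : ℝ} (hx : 0 ≤ x) :
    Summable fun n : ℕ => x ^ (2 * n + 1) /
      ((2 : ℝ) ^ (2 * n + 1) * (n.factorial : ℝ) * (((n + 1).factorial : ℝ))) :=
  Summable.of_nonneg_of_le (fun n => by positivity) (I1_term_le_I0_terms x)
    (((summable_I0 x).add ((summable_nat_add_iff 1).2 (summable_I0 x))).div_const 2)

theorem one_le_I0 (x : ℝ) : 1 ≤ I0 x := by
  have h := (summable_I0 x).le_tsum 0 fun n _ => by rw [pow_mul]; positivity
  simpa [I0] using h

theorem I1_nonneg {x : ℝ} (hx : 0 ≤ x) : 0 ≤ I1 x :=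
  tsum_nonneg fun n => by positivity

theorem I1_le_I1 {x y : ℝ} (hx : 0 ≤ x) (hxy : x ≤ y) : I1 x ≤ I1 y :=
  (summable_I1 hx).tsum_le_tsum (fun n => by gcongr) (summable_I1 (hx.trans hxy))

theorem I1_le_I0 {x : ℝ} (hx : 0 ≤ x) : I1 x ≤ I0 x := by
  have hs := summable_I0 x
  have hs' := (summable_nat_add_iff 1).2 hs
  have h := (summable_I1 hx).tsum_le_tsum (I1_term_le_I0_terms x) ((hs.add hs').div_const 2)
  rw [tsum_div_const, hs.tsum_add hs'] at h
  have h₀ := hs.tsum_eq_zero_add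
  simp only [mul_zero, pow_zero, Nat.factorial_zero, Nat.cast_one, one_pow, mul_one, div_one]
    at h₀
  unfold I1 I0
  linarith

/-- For `0 ≤ r ≤ R`, the quotient `I₁(√a r) / (√a I₀(√a R))` vanishes as `a → ∞`. -/
theorem tendsto_I1_div_sqrt_mul_I0 {r R : ℝ} (hr : 0 ≤ r) (hrR : r ≤ R) :
    Tendsto (fun a => I1 (√a * r) / (√a * I0 (√a * R))) atTop (nhds 0) := by
  refine squeeze_zero' ?_ ?_ Real.tendsto_sqrt_atTop.inv_tendsto_atTop
  · filter_upwards with a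
    have := one_le_I0 (√a * R)
    have := I1_nonneg (mul_nonneg (Real.sqrt_nonneg a) hr)
    positivity
  · filter_upwards [eventually_gt_atTop 0] with a ha
    have hs := Real.sqrt_pos.2 ha
    have h₀ : 0 < I0 (√a * R) := one_pos.trans_le (one_le_I0 _)
    have h : I1 (√a * r) ≤ I0 (√a * R) :=
      (I1_le_I1 (by positivity) (by gcongr)).trans
        (I1_le_I0 (mul_nonneg hs.le (hr.trans hrR)))
    rw [Pi.inv_apply, div_le_iff₀ (by positivity), inv_mul_cancel_left₀ hs.ne']
    exact h

/-- as `a → ∞` (i.e. `L_c → 0`), the closed-form radial displacement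
profile tends to the classical linear-elastic solution: `F(a,r) → r` for `0 < r < R`. -/
theorem displacement_limit_Lc_zero (R A B ξ₁ ξ₂ ξ₃ : ℝ) (hR : 0 < R)
    (hA : A ≠ 0) (hξ₁ : ξ₁ ≠ 0) :
    let F : ℝ → ℝ → ℝ := fun a r =>
      (A * r * (I1 (Real.sqrt a * R) * (2 * ξ₁ - ξ₂) -
          ξ₁ * Real.sqrt a * R * I0 (Real.sqrt a * R)) +
        B * ξ₃ * R * I1 (Real.sqrt a * r)) /
      (A * (I1 (Real.sqrt a * R) * (2 * ξ₁ - ξ₂) -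
          ξ₁ * Real.sqrt a * R * I0 (Real.sqrt a * R)) +
        B * ξ₃ * I1 (Real.sqrt a * R))
    ∀ r : ℝ, 0 < r → r < R →
      Filter.Tendsto (fun a => F a r) Filter.atTop (nhds r) := by
  intro F r hr hrR
  have hu := tendsto_I1_div_sqrt_mul_I0 hR.le le_rfl
  have hv := tendsto_I1_div_sqrt_mul_I0 hr.le hrR.le
  have hw := (hu.mul_const (2 * ξ₁ - ξ₂)).sub_const (ξ₁ * R)
  have hnum := (hw.const_mul (A * r)).add (hv.const_mul (B * ξ₃ * R))
  have hden := (hw.const_mul A).add (hu.const_mul (B * ξ₃))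
  have hlim := hnum.div hden (by simp [hA, hξ₁, hR.ne'])
  have hr_eq : (A * r * (0 * (2 * ξ₁ - ξ₂) - ξ₁ * R) + B * ξ₃ * R * 0) /
      (A * (0 * (2 * ξ₁ - ξ₂) - ξ₁ * R) + B * ξ₃ * 0) = r := by
    have := hR.ne'
    field_simp
    ring
  rw [hr_eq] at hlim
  refine hlim.congr' ?_
  filter_upwards [eventually_gt_atTop 0] with a ha
  have hs : √a ≠ 0 := (Real.sqrt_pos.2 ha).ne'
  have h₀ : I0 (√a * R) ≠ 0 := (one_pos.trans_le (one_le_I0 _)).ne'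
  simp only [F, Pi.div_apply]
  refine (mul_div_mul_right _ _ (mul_ne_zero hs h₀)).symm.trans ?_
  congr 1 <;> field_simp
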